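/- arXiv:2308.10722 — 6 statements merged into one kernel-verified Lean document; each statement's English description precedes it below -/
import Mathlib

section
/- Let t, m ≥ 1, λ > 0, ε ≥ 0, let X ∈ ℝ^{t×m}, μ, γ ∈ ℝ^m, η ∈ ℝ^t, with ‖μ‖₂ ≤ √m. Set M := λ·I_m + XᵀX, μ̂ := M⁻¹ Xᵀ (Xμ + η), and s := Xᵀη − ε·XᵀXγ. Then for every x ∈ ℝ^m, |xᵀ μ̂ − xᵀ μ| ≤ ‖x‖_{M⁻¹} · ( ‖s‖_{M⁻¹} + ε·‖XᵀXγ‖_{M⁻¹} + √(λ m) ). -/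
open Matrix

lemma cs_aux {m : ℕ} {A : Matrix (Fin m) (Fin m) ℝ} (hA : A.PosSemidef) (x y : Fin m → ℝ) :
    |x ⬝ᵥ A.mulVec y| ≤ Real.sqrt (x ⬝ᵥ A.mulVec x) * Real.sqrt (y ⬝ᵥ A.mulVec y) := by
  have hnn : ∀ z : Fin m → ℝ, 0 ≤ z ⬝ᵥ A.mulVec z := fun z => by
    simpa using hA.dotProduct_mulVec_nonneg z
  have hT : Aᵀ = A := by simpa using hA.isHermitian.eq
  have hsym : y ⬝ᵥ A.mulVec x = x ⬝ᵥ A.mulVec y := by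
    rw [dotProduct_mulVec, ← mulVec_transpose, hT, dotProduct_comm]
  have hd := discrim_le_zero (a := y ⬝ᵥ A.mulVec y) (b := 2 * (x ⬝ᵥ A.mulVec y))
    (c := x ⬝ᵥ A.mulVec x) (fun r => by
      have h := hnn (x + r • y)
      simp only [mulVec_add, mulVec_smul, dotProduct_add, add_dotProduct, smul_dotProduct,
        dotProduct_smul, smul_eq_mul, hsym] at h
      linarith)
  rw [← Real.sqrt_mul (hnn x)]
  apply Real.abs_le_sqrt
  unfold discrim at hd
  nlinarith

/-- `|xᵀμ̂ − xᵀμ| ≤ ‖x‖_{M⁻¹}(‖s‖_{M⁻¹} + ε‖XᵀXγ‖_{M⁻¹} + √(λm))`. -/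
theorem stmt_2 (t m : ℕ) (ht : 1 ≤ t) (hm : 1 ≤ m) (lam ε : ℝ)
    (hlam : 0 < lam) (hε : 0 ≤ ε)
    (X : Matrix (Fin t) (Fin m) ℝ) (μ γ : Fin m → ℝ) (η : Fin t → ℝ)
    (hμ : Real.sqrt (μ ⬝ᵥ μ) ≤ Real.sqrt m)
    (M : Matrix (Fin m) (Fin m) ℝ)
    (hM : M = lam • (1 : Matrix (Fin m) (Fin m) ℝ) + Xᵀ * X)
    (μhat : Fin m → ℝ) (hμhat : μhat = M⁻¹.mulVec (Xᵀ.mulVec (X.mulVec μ + η)))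
    (s : Fin m → ℝ) (hs : s = Xᵀ.mulVec η - ε • (Xᵀ * X).mulVec γ) :
    ∀ x : Fin m → ℝ,
      |x ⬝ᵥ μhat - x ⬝ᵥ μ| ≤
        Real.sqrt (x ⬝ᵥ M⁻¹.mulVec x) *
          (Real.sqrt (s ⬝ᵥ M⁻¹.mulVec s) +
            ε * Real.sqrt ((Xᵀ * X).mulVec γ ⬝ᵥ M⁻¹.mulVec ((Xᵀ * X).mulVec γ)) +
            Real.sqrt (lam * m)) := by
  intro x
  have hX : (Xᵀ * X).PosSemidef := by simpa using posSemidef_conjTranspose_mul_self X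
  have hMp : M.PosDef := by
    rw [hM]
    exact (PosDef.one.smul hlam).add_posSemidef hX
  have hA : M⁻¹.PosSemidef := hMp.inv.posSemidef
  have hdet : IsUnit M.det := (isUnit_iff_isUnit_det M).1 hMp.isUnit
  have hMμ : M.mulVec μ = lam • μ + (Xᵀ * X).mulVec μ := by
    rw [hM, add_mulVec, smul_mulVec, one_mulVec]
  have key : μhat - μ = M⁻¹.mulVec (s + ε • (Xᵀ * X).mulVec γ - lam • μ) := by
    have h1 : μ = M⁻¹.mulVec (M.mulVec μ) := by
      rw [mulVec_mulVec, nonsing_inv_mul M hdet, one_mulVec]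
    rw [hμhat]
    conv_lhs => arg 2; rw [h1]
    rw [← mulVec_sub, hMμ, hs, mulVec_add, mulVec_mulVec]
    congr 1
    abel
  have hlast : lam * Real.sqrt (μ ⬝ᵥ M⁻¹.mulVec μ) ≤ Real.sqrt (lam * m) := by
    have hμm : μ ⬝ᵥ μ ≤ m := (Real.sqrt_le_sqrt_iff (by positivity)).1 hμ
    set v := M⁻¹.mulVec μ with hv
    have hMv : μ = lam • v + (Xᵀ * X).mulVec v := by
      have : M.mulVec v = μ := by
        rw [hv, mulVec_mulVec, mul_nonsing_inv M hdet, one_mulVec]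
      rw [← this, hM, add_mulVec, smul_mulVec, one_mulVec]
    have h0 : 0 ≤ v ⬝ᵥ (Xᵀ * X).mulVec v := by simpa using hX.dotProduct_mulVec_nonneg v
    set w := (Xᵀ * X).mulVec v with hw
    have h1 : 0 ≤ w ⬝ᵥ w := by simpa using dotProduct_star_self_nonneg w
    have h2 : μ ⬝ᵥ μ = lam * (μ ⬝ᵥ v) + lam * (v ⬝ᵥ w) + w ⬝ᵥ w := by
      have e1 : μ ⬝ᵥ μ = lam * (μ ⬝ᵥ v) + μ ⬝ᵥ w := by
        conv_lhs => arg 2; rw [hMv]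
        rw [dotProduct_add, dotProduct_smul, smul_eq_mul]
      have e2 : μ ⬝ᵥ w = lam * (v ⬝ᵥ w) + w ⬝ᵥ w := by
        conv_lhs => arg 1; rw [hMv]
        rw [add_dotProduct, smul_dotProduct, smul_eq_mul]
      linarith
    have h3 : lam * (μ ⬝ᵥ v) ≤ m := by nlinarith [mul_nonneg hlam.le h0]
    have h4 : 0 ≤ μ ⬝ᵥ v := by simpa using hA.dotProduct_mulVec_nonneg μ
    apply Real.le_sqrt_of_sq_le
    rw [mul_pow, Real.sq_sqrt h4]
    nlinarith
  rw [← dotProduct_sub, key]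
  have e : x ⬝ᵥ M⁻¹.mulVec (s + ε • (Xᵀ * X).mulVec γ - lam • μ) =
      x ⬝ᵥ M⁻¹.mulVec s + ε * (x ⬝ᵥ M⁻¹.mulVec ((Xᵀ * X).mulVec γ))
        - lam * (x ⬝ᵥ M⁻¹.mulVec μ) := by
    simp only [mulVec_add, mulVec_sub, mulVec_smul, dotProduct_add, dotProduct_sub,
      dotProduct_smul, smul_eq_mul]
  rw [e]
  have c1 := cs_aux hA x s
  have c2 := mul_le_mul_of_nonneg_left (cs_aux hA x ((Xᵀ * X).mulVec γ)) hε
  have c3 := mul_le_mul_of_nonneg_left (cs_aux hA x μ) hlam.le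
  have c4 := mul_le_mul_of_nonneg_left hlast (Real.sqrt_nonneg (x ⬝ᵥ M⁻¹.mulVec x))
  have t1 := abs_sub (x ⬝ᵥ M⁻¹.mulVec s + ε * (x ⬝ᵥ M⁻¹.mulVec ((Xᵀ * X).mulVec γ)))
    (lam * (x ⬝ᵥ M⁻¹.mulVec μ))
  have t2 := abs_add_le (x ⬝ᵥ M⁻¹.mulVec s) (ε * (x ⬝ᵥ M⁻¹.mulVec ((Xᵀ * X).mulVec γ)))
  rw [abs_mul, abs_of_nonneg hlam.le] at t1
  rw [abs_mul, abs_of_nonneg hε] at t2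
  linarith
end

section
/- Let t, m ≥ 1, λ > 0, and X ∈ ℝ^{t×m}. Set M := λ·I_m + XᵀX. Then for every v ∈ ℝ^m, ‖XᵀX v‖_{M⁻¹} ≤ ‖X v‖₂, i.e., vᵀ XᵀX M⁻¹ XᵀX v ≤ ‖X v‖₂². -/
open Matrix

/-- `‖XᵀXv‖_{M⁻¹} ≤ ‖Xv‖₂`, i.e. `vᵀXᵀX M⁻¹ XᵀX v ≤ ‖Xv‖₂²`. -/
theorem stmt_6 (t m : ℕ) (ht : 1 ≤ t) (hm : 1 ≤ m) (lam : ℝ) (hlam : 0 < lam)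
    (X : Matrix (Fin t) (Fin m) ℝ)
    (M : Matrix (Fin m) (Fin m) ℝ)
    (hM : M = lam • (1 : Matrix (Fin m) (Fin m) ℝ) + Xᵀ * X) :
    ∀ v : Fin m → ℝ,
      Real.sqrt ((Xᵀ * X).mulVec v ⬝ᵥ M⁻¹.mulVec ((Xᵀ * X).mulVec v)) ≤
          Real.sqrt (X.mulVec v ⬝ᵥ X.mulVec v) ∧
      (Xᵀ * X).mulVec v ⬝ᵥ M⁻¹.mulVec ((Xᵀ * X).mulVec v) ≤
          X.mulVec v ⬝ᵥ X.mulVec v := by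
  intro v
  have hpd : M.PosDef := by
    rw [hM]
    refine Matrix.PosDef.add_posSemidef (Matrix.PosDef.one.smul hlam) ?_
    simpa using Matrix.posSemidef_conjTranspose_mul_self X
  have hdet : IsUnit M.det := (Matrix.isUnit_iff_isUnit_det M).1 hpd.isUnit
  have key : (Xᵀ * X).mulVec v ⬝ᵥ M⁻¹.mulVec ((Xᵀ * X).mulVec v) ≤
      X.mulVec v ⬝ᵥ X.mulVec v := by
    obtain ⟨w, hw⟩ : ∃ w, w = M⁻¹.mulVec ((Xᵀ * X).mulVec v) := ⟨_, rfl⟩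
    have hMw : M.mulVec w = (Xᵀ * X).mulVec v := by
      rw [hw, Matrix.mulVec_mulVec, Matrix.mul_nonsing_inv M hdet, Matrix.one_mulVec]
    rw [← hw]
    have gram : ∀ a b : Fin m → ℝ,
        (Xᵀ * X).mulVec a ⬝ᵥ b = X.mulVec a ⬝ᵥ X.mulVec b := by
      intro a b
      rw [← Matrix.mulVec_mulVec, Matrix.mulVec_transpose, ← Matrix.dotProduct_mulVec]
    have h1 : (Xᵀ * X).mulVec v ⬝ᵥ w = lam * (w ⬝ᵥ w) + X.mulVec w ⬝ᵥ X.mulVec w := by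
      rw [← hMw, hM, Matrix.add_mulVec, add_dotProduct, gram, Matrix.smul_mulVec,
        Matrix.one_mulVec, smul_dotProduct, smul_eq_mul]
    have h2 := gram v w
    have hnn : ∀ {k : ℕ} (u : Fin k → ℝ), 0 ≤ u ⬝ᵥ u := fun u =>
      Finset.sum_nonneg fun i _ => mul_self_nonneg (u i)
    have h3 := mul_nonneg hlam.le (hnn w)
    have h4 := hnn (X.mulVec v - X.mulVec w)
    rw [sub_dotProduct, dotProduct_sub, dotProduct_sub,
      dotProduct_comm (X.mulVec w) (X.mulVec v)] at h4
    linarith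
  exact ⟨Real.sqrt_le_sqrt key, key⟩
end

section
/- Let t, m ≥ 1, λ > 0, and let X ∈ ℝ^{t×m} be a matrix all of whose entries lie in [0, 1]. Set M := λ·I_m + XᵀX. Then for every γ ∈ ℝ^m, ‖XᵀX γ‖_{M⁻¹} ≤ ‖γ‖_∞ · m · √t. -/
open Matrix

/-- Lemma 10-20-B: `‖XᵀXγ‖_{M⁻¹} ≤ ‖γ‖_∞ · m · √t`. -/
theorem stmt_8 (t m : ℕ) (ht : 1 ≤ t) (hm : 1 ≤ m) (lam : ℝ) (hlam : 0 < lam)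
    (X : Matrix (Fin t) (Fin m) ℝ)
    (hX : ∀ i j, X i j ∈ Set.Icc (0 : ℝ) 1)
    (M : Matrix (Fin m) (Fin m) ℝ)
    (hM : M = lam • (1 : Matrix (Fin m) (Fin m) ℝ) + Xᵀ * X) :
    ∀ γ : Fin m → ℝ,
      Real.sqrt ((Xᵀ * X).mulVec γ ⬝ᵥ M⁻¹.mulVec ((Xᵀ * X).mulVec γ)) ≤
        (⨆ j, |γ j|) * m * Real.sqrt t := by
  intro γ
  have hnn : ∀ {n : ℕ} (u : Fin n → ℝ), 0 ≤ u ⬝ᵥ u := fun u =>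
    Finset.sum_nonneg fun i _ => mul_self_nonneg (u i)
  have hgram : ∀ a b : Fin m → ℝ, (Xᵀ * X).mulVec a ⬝ᵥ b = X.mulVec a ⬝ᵥ X.mulVec b := by
    intro a b
    rw [← Matrix.mulVec_mulVec, Matrix.mulVec_transpose, ← Matrix.dotProduct_mulVec]
  have hMv : ∀ a : Fin m → ℝ, M.mulVec a ⬝ᵥ a = lam * (a ⬝ᵥ a) + X.mulVec a ⬝ᵥ X.mulVec a := by
    intro a
    rw [hM, Matrix.add_mulVec, add_dotProduct, hgram, Matrix.smul_mulVec, Matrix.one_mulVec,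
      smul_dotProduct, smul_eq_mul]
  have hdet : IsUnit M.det := by
    rw [isUnit_iff_ne_zero]
    intro h0
    obtain ⟨a, ha, hMa⟩ := Matrix.exists_mulVec_eq_zero_iff.mpr h0
    have h1 := hMv a
    rw [hMa, zero_dotProduct] at h1
    have h2 := hnn (X.mulVec a)
    have h3 := hnn a
    have h4 : a ⬝ᵥ a = 0 := by nlinarith [mul_nonneg hlam.le h3]
    exact ha (dotProduct_self_eq_zero.mp h4)
  set w := M⁻¹.mulVec ((Xᵀ * X).mulVec γ) with hw
  have hMw : M.mulVec w = (Xᵀ * X).mulVec γ := by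
    rw [hw, Matrix.mulVec_mulVec, Matrix.mul_nonsing_inv _ hdet, Matrix.one_mulVec]
  have hq1 := hMv w
  rw [hMw] at hq1
  have hq2 := hgram γ w
  have hd := hnn (X.mulVec γ - X.mulVec w)
  rw [sub_dotProduct, dotProduct_sub, dotProduct_sub,
    dotProduct_comm (X.mulVec w) (X.mulVec γ)] at hd
  have hlw := mul_nonneg hlam.le (hnn w)
  have hle : (Xᵀ * X).mulVec γ ⬝ᵥ w ≤ X.mulVec γ ⬝ᵥ X.mulVec γ := by linarith
  set G := ⨆ j, |γ j| with hG
  have hGj : ∀ j, |γ j| ≤ G := fun j =>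
    le_ciSup (f := fun j => |γ j|) (Set.finite_range _).bddAbove j
  have hG0 : 0 ≤ G := (abs_nonneg _).trans (hGj ⟨0, hm⟩)
  have hrow : ∀ i, |X.mulVec γ i| ≤ m * G := by
    intro i
    calc |X.mulVec γ i| ≤ ∑ j, |X i j * γ j| := by
          simp only [Matrix.mulVec, dotProduct]
          exact Finset.abs_sum_le_sum_abs _ _
      _ ≤ ∑ _j : Fin m, G := by
        refine Finset.sum_le_sum fun j _ => ?_
        rw [abs_mul, abs_of_nonneg (hX i j).1]
        nlinarith [(hX i j).2, (hX i j).1, hGj j, abs_nonneg (γ j)]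
      _ = m * G := by simp
  have hz : X.mulVec γ ⬝ᵥ X.mulVec γ ≤ t * (m * G) ^ 2 := by
    calc X.mulVec γ ⬝ᵥ X.mulVec γ ≤ ∑ _i : Fin t, (m * G) ^ 2 := by
          refine Finset.sum_le_sum fun i _ => ?_
          rw [← pow_two, ← sq_abs]
          exact pow_le_pow_left₀ (abs_nonneg _) (hrow i) 2
      _ = t * (m * G) ^ 2 := by simp
  apply Real.sqrt_le_iff.mpr
  refine ⟨by positivity, ?_⟩
  rw [mul_pow, Real.sq_sqrt (Nat.cast_nonneg t)]
  calc _ ≤ _ := hle.trans hz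
    _ = _ := by ring
end

section
/- Let m ≥ 1 and t ≥ 1, and let x_1, …, x_t ∈ ℝ^m be vectors with ‖x_i‖₂ ≤ 1 for all i. For each i ∈ {1, …, t} define M_i := I_m + Σ_{j<i} x_j x_jᵀ. Then Σ_{i=1}^t √(x_iᵀ M_i⁻¹ x_i) ≤ √(2 m t · log(1 + t)). -/
open Matrix

/-- The regularized Gram matrix. -/
noncomputable def gramG {m : ℕ} (y : ℕ → Fin m → ℝ) (n : ℕ) : Matrix (Fin m) (Fin m) ℝ :=
  1 + ∑ j ∈ Finset.range n, vecMulVec (y j) (y j)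

lemma gramG_succ {m : ℕ} (y : ℕ → Fin m → ℝ) (n : ℕ) :
    gramG y (n+1) = gramG y n + vecMulVec (y n) (y n) := by
  simp [gramG, Finset.sum_range_succ, add_assoc]

lemma gram_psd {m : ℕ} (y : ℕ → Fin m → ℝ) (n : ℕ) :
    (∑ j ∈ Finset.range n, vecMulVec (y j) (y j)).PosSemidef := by
  apply Matrix.posSemidef_sum
  intro i _
  simpa using Matrix.posSemidef_vecMulVec_self_star (y i)

lemma gramG_pd {m : ℕ} (y : ℕ → Fin m → ℝ) (n : ℕ) : (gramG y n).PosDef :=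
  Matrix.PosDef.one.add_posSemidef (gram_psd y n)

lemma gramG_quad {m : ℕ} (y : ℕ → Fin m → ℝ) (n : ℕ) (w : Fin m → ℝ) :
    w ⬝ᵥ w ≤ w ⬝ᵥ (gramG y n) *ᵥ w := by
  have h := (gram_psd y n).dotProduct_mulVec_nonneg w
  simp only [star_trivial] at h
  simp only [gramG, add_mulVec, one_mulVec, dotProduct_add]
  linarith

lemma gramG_u {m : ℕ} (y : ℕ → Fin m → ℝ) (n : ℕ) (hy : y n ⬝ᵥ y n ≤ 1) :
    0 ≤ y n ⬝ᵥ (gramG y n)⁻¹ *ᵥ y n ∧ y n ⬝ᵥ (gramG y n)⁻¹ *ᵥ y n ≤ 1 := by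
  have hdet : IsUnit (gramG y n).det := (gramG_pd y n).det_pos.ne'.isUnit
  set w := (gramG y n)⁻¹ *ᵥ y n with hw
  have h1 : gramG y n *ᵥ w = y n := by
    rw [hw, mulVec_mulVec, mul_nonsing_inv _ hdet, one_mulVec]
  have h2 := gramG_quad y n w
  rw [h1, dotProduct_comm w (y n)] at h2
  have h3 : 0 ≤ w ⬝ᵥ w := by
    simp only [dotProduct]; exact Finset.sum_nonneg fun i _ => mul_self_nonneg _
  have h4 : (y n ⬝ᵥ w)^2 ≤ (y n ⬝ᵥ y n) * (w ⬝ᵥ w) := by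
    have := Finset.sum_mul_sq_le_sq_mul_sq Finset.univ (y n) w
    simpa [dotProduct, pow_two] using this
  refine ⟨by linarith, ?_⟩
  by_contra hc
  push Not at hc
  nlinarith

lemma gramG_det {m : ℕ} (y : ℕ → Fin m → ℝ) (n : ℕ) :
    (gramG y (n+1)).det = (gramG y n).det * (1 + y n ⬝ᵥ (gramG y n)⁻¹ *ᵥ y n) := by
  have hdet : IsUnit (gramG y n).det := (gramG_pd y n).det_pos.ne'.isUnit
  rw [gramG_succ, vecMulVec_eq Unit, det_add_replicateCol_mul_replicateRow hdet]
  congr 1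
  rw [det_unique]
  simp only [Matrix.add_apply, Matrix.one_apply_eq]
  congr 1
  rw [Matrix.mul_assoc, ← replicateCol_mulVec, replicateRow_mul_replicateCol_apply]

lemma gramG_sum {m : ℕ} (y : ℕ → Fin m → ℝ) (hy : ∀ n, y n ⬝ᵥ y n ≤ 1) (n : ℕ) :
    ∑ k ∈ Finset.range n, y k ⬝ᵥ (gramG y k)⁻¹ *ᵥ y k ≤ 2 * Real.log (gramG y n).det := by
  induction n with
  | zero => simp [gramG]
  | succ n ih =>
    obtain ⟨h0, h1⟩ := gramG_u y n (hy n)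
    rw [Finset.sum_range_succ, gramG_det, Real.log_mul (gramG_pd y n).det_pos.ne' (by linarith)]
    set u := y n ⬝ᵥ (gramG y n)⁻¹ *ᵥ y n
    have h2 := Real.one_sub_inv_le_log_of_pos (show 0 < 1 + u by linarith)
    have h3 : u / 2 ≤ 1 - (1+u)⁻¹ := by
      have : 1 - (1+u)⁻¹ = u / (1+u) := by field_simp; ring
      rw [this]
      exact div_le_div_of_nonneg_left h0 (by linarith) (by linarith)
    linarith

lemma gramG_trace {m : ℕ} (y : ℕ → Fin m → ℝ) (hy : ∀ n, y n ⬝ᵥ y n ≤ 1) (n : ℕ) :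
    (gramG y n).trace ≤ m + n := by
  induction n with
  | zero => simp [gramG]
  | succ n ih =>
    rw [gramG_succ, trace_add, trace_vecMulVec]
    have := hy n
    push_cast
    linarith

lemma gramG_logdet {m : ℕ} (hm : 1 ≤ m) (y : ℕ → Fin m → ℝ) (hy : ∀ n, y n ⬝ᵥ y n ≤ 1) (n : ℕ) :
    Real.log (gramG y n).det ≤ m * Real.log (1 + n) := by
  have hp := gramG_pd y n
  have hd := hp.isHermitian.det_eq_prod_eigenvalues
  have ht := hp.isHermitian.trace_eq_sum_eigenvalues
  have htr := gramG_trace y hy n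
  simp only [RCLike.ofReal_real_eq_id, id] at hd ht
  rw [hd, Real.log_prod (fun i _ => (hp.eigenvalues_pos i).ne')]
  rw [ht] at htr
  have hn : (0:ℝ) < 1 + n := by positivity
  have key : ∀ i ∈ Finset.univ, Real.log (hp.isHermitian.eigenvalues i) ≤
      Real.log (1 + n) + (hp.isHermitian.eigenvalues i / (1+n) - 1) := by
    intro i _
    have := Real.log_le_sub_one_of_pos (div_pos (hp.eigenvalues_pos i) hn)
    rw [Real.log_div (hp.eigenvalues_pos i).ne' hn.ne'] at this
    linarith
  refine (Finset.sum_le_sum key).trans ?_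
  rw [Finset.sum_add_distrib, Finset.sum_sub_distrib, ← Finset.sum_div]
  simp only [Finset.sum_const, Finset.card_univ, Fintype.card_fin, nsmul_eq_mul, mul_one]
  have hm' : (1:ℝ) ≤ m := by exact_mod_cast hm
  have : (∑ i, hp.isHermitian.eigenvalues i) / (1+n) ≤ m := by
    rw [div_le_iff₀ hn]
    nlinarith [Nat.cast_nonneg (α := ℝ) n]
  linarith

/-- Elliptical potential bound: `Σ_i ‖x_i‖_{M_i⁻¹} ≤ √(2mt log(1+t))`. -/
theorem stmt_9 (m t : ℕ) (hm : 1 ≤ m) (ht : 1 ≤ t)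
    (x : Fin t → Fin m → ℝ) (hx : ∀ i, Real.sqrt (x i ⬝ᵥ x i) ≤ 1)
    (M : Fin t → Matrix (Fin m) (Fin m) ℝ)
    (hM : ∀ i, M i = (1 : Matrix (Fin m) (Fin m) ℝ) +
      ∑ j ∈ Finset.Iio i, vecMulVec (x j) (x j)) :
    ∑ i, Real.sqrt (x i ⬝ᵥ (M i)⁻¹.mulVec (x i)) ≤
      Real.sqrt (2 * m * t * Real.log (1 + t)) := by
  let y : ℕ → Fin m → ℝ := fun k => if h : k < t then x ⟨k, h⟩ else 0
  have hyx : ∀ i : Fin t, y i = x i := fun i => by simp [y]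
  have hy : ∀ n, y n ⬝ᵥ y n ≤ 1 := by
    intro n
    by_cases h : n < t
    · have := hx ⟨n, h⟩
      rw [Real.sqrt_le_iff, one_pow] at this
      replace this := this.2
      simpa [y, h] using this
    · simp [y, h]
  have hMG : ∀ i : Fin t, M i = gramG y i := by
    intro i
    rw [hM, gramG, ← Nat.Iio_eq_range, ← Fin.map_valEmbedding_Iio, Finset.sum_map]
    simp [hyx]
  have hu : ∀ i : Fin t, x i ⬝ᵥ (M i)⁻¹.mulVec (x i) = y i ⬝ᵥ (gramG y i)⁻¹ *ᵥ y i := by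
    intro i; rw [hMG, hyx]
  simp only [hu]
  apply Real.le_sqrt_of_sq_le
  refine (sq_sum_le_card_mul_sum_sq).trans ?_
  have h1 : ∑ i : Fin t, Real.sqrt (y i ⬝ᵥ (gramG y i)⁻¹ *ᵥ y i) ^ 2 =
      ∑ k ∈ Finset.range t, y k ⬝ᵥ (gramG y k)⁻¹ *ᵥ y k := by
    rw [← Fin.sum_univ_eq_sum_range (fun k => y k ⬝ᵥ (gramG y k)⁻¹ *ᵥ y k)]
    exact Finset.sum_congr rfl fun i _ => Real.sq_sqrt (gramG_u y i (hy i)).1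
  rw [h1]
  have h2 := gramG_sum y hy t
  have h3 := gramG_logdet hm y hy t
  simp only [Finset.card_univ, Fintype.card_fin]
  calc (t:ℝ) * _ ≤ t * (2 * (m * Real.log (1 + t))) := by gcongr; linarith
    _ = _ := by ring
end

section
/- Let m ≥ 1, T ≥ 1, β ≥ 0, and let x_1, …, x_T ∈ ℝ^m with ‖x_t‖₂ ≤ 1 for all t; set M_t := I_m + Σ_{i<t} x_i x_iᵀ. Let μ ∈ ℝ^m and let μ̃_1, …, μ̃_T ∈ ℝ^m satisfy ‖μ̃_t − μ‖_{M_t} ≤ β for every t ∈ {1, …, T}. Then Σ_{t=1}^T |μ̃_tᵀ x_t − μᵀ x_t| ≤ β · √(2 m T · log(1 + T)). -/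
open Matrix

lemma aux_log {w : ℝ} (h0 : 0 ≤ w) (h1 : w ≤ 1) : w ≤ 2 * Real.log (1 + w) := by
  have h := Real.one_sub_inv_le_log_of_pos (show 0 < 1 + w by linarith)
  have : w / 2 ≤ 1 - (1 + w)⁻¹ := by
    have h2 : 1 - (1 + w)⁻¹ = w / (1 + w) := by
      field_simp
      ring
    rw [h2]
    gcongr
    linarith
  linarith

/-- The regularised Gram matrices. -/
noncomputable def auxN {m : ℕ} (y : ℕ → Fin m → ℝ) (k : ℕ) : Matrix (Fin m) (Fin m) ℝ :=
  1 + ∑ i ∈ Finset.range k, vecMulVec (y i) (y i)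

lemma auxN_psd {m : ℕ} (y : ℕ → Fin m → ℝ) (k : ℕ) :
    (∑ i ∈ Finset.range k, vecMulVec (y i) (y i)).PosSemidef :=
  Matrix.posSemidef_sum _ fun i _ => by
    simpa using Matrix.posSemidef_vecMulVec_self_star (y i)

lemma auxN_pd {m : ℕ} (y : ℕ → Fin m → ℝ) (k : ℕ) : (auxN y k).PosDef :=
  Matrix.PosDef.one.add_posSemidef (auxN_psd y k)

lemma auxN_ge {m : ℕ} (y : ℕ → Fin m → ℝ) (k : ℕ) (z : Fin m → ℝ) :
    z ⬝ᵥ z ≤ z ⬝ᵥ (auxN y k *ᵥ z) := by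
  have h := (auxN_psd y k).dotProduct_mulVec_nonneg z
  simp only [star_trivial] at h
  rw [auxN, add_mulVec, one_mulVec, dotProduct_add]
  linarith

/-- the squared potential. -/
noncomputable def auxw {m : ℕ} (y : ℕ → Fin m → ℝ) (k : ℕ) : ℝ :=
  y k ⬝ᵥ ((auxN y k)⁻¹ *ᵥ y k)

lemma auxN_inv {m : ℕ} (y : ℕ → Fin m → ℝ) (k : ℕ) (v : Fin m → ℝ) :
    auxN y k *ᵥ ((auxN y k)⁻¹ *ᵥ v) = v := by
  rw [mulVec_mulVec, mul_nonsing_inv _ ((auxN_pd y k).det_pos.ne'.isUnit), one_mulVec]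

lemma auxN_symm {m : ℕ} (y : ℕ → Fin m → ℝ) (k : ℕ) (u v : Fin m → ℝ) :
    u ⬝ᵥ (auxN y k *ᵥ v) = v ⬝ᵥ (auxN y k *ᵥ u) := by
  have h : (auxN y k)ᵀ = auxN y k := by
    have := (auxN_pd y k).isHermitian
    simpa [Matrix.IsHermitian, conjTranspose_eq_transpose_of_trivial] using this
  rw [dotProduct_mulVec, ← mulVec_transpose, h, dotProduct_comm]

lemma auxw_ge {m : ℕ} (y : ℕ → Fin m → ℝ) (k : ℕ) :
    ((auxN y k)⁻¹ *ᵥ y k) ⬝ᵥ ((auxN y k)⁻¹ *ᵥ y k) ≤ auxw y k := by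
  have h := auxN_ge y k ((auxN y k)⁻¹ *ᵥ y k)
  rwa [auxN_inv, dotProduct_comm _ (y k)] at h

lemma dp_nonneg {m : ℕ} (z : Fin m → ℝ) : 0 ≤ z ⬝ᵥ z :=
  Finset.sum_nonneg fun i _ => mul_self_nonneg (z i)

lemma auxw_nonneg {m : ℕ} (y : ℕ → Fin m → ℝ) (k : ℕ) : 0 ≤ auxw y k :=
  (dp_nonneg _).trans (auxw_ge y k)

lemma auxw_le_one {m : ℕ} (y : ℕ → Fin m → ℝ) (k : ℕ) (hy : y k ⬝ᵥ y k ≤ 1) :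
    auxw y k ≤ 1 := by
  have h := auxw_ge y k
  have h0 := auxw_nonneg y k
  set z := (auxN y k)⁻¹ *ᵥ y k with hz
  have hw : auxw y k = y k ⬝ᵥ z := rfl
  have h2 := dp_nonneg (y k - z)
  simp only [sub_dotProduct, dotProduct_sub, dotProduct_comm z (y k)] at h2
  linarith

lemma aux_cs {m : ℕ} (y : ℕ → Fin m → ℝ) (k : ℕ) (v : Fin m → ℝ) :
    (v ⬝ᵥ y k) ^ 2 ≤ (v ⬝ᵥ (auxN y k *ᵥ v)) * auxw y k := by
  have key : ∀ s : ℝ, 0 ≤ auxw y k * (s * s) + (-2 * (v ⬝ᵥ y k)) * s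
      + v ⬝ᵥ (auxN y k *ᵥ v) := by
    intro s
    set z := (auxN y k)⁻¹ *ᵥ y k with hz
    have h := (dp_nonneg _).trans (auxN_ge y k (v - s • z))
    have h1 : auxN y k *ᵥ z = y k := auxN_inv y k _
    have h2 : z ⬝ᵥ (auxN y k *ᵥ v) = v ⬝ᵥ y k := by rw [auxN_symm, h1]
    have hw : auxw y k = z ⬝ᵥ y k := by rw [dotProduct_comm]; rfl
    simp only [mulVec_sub, mulVec_smul, h1, sub_dotProduct, dotProduct_sub, smul_dotProduct,
      dotProduct_smul, h2, smul_eq_mul] at h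
    rw [hw]
    linarith
  have := discrim_le_zero key
  rw [discrim] at this
  linarith

lemma auxN_det_succ {m : ℕ} (y : ℕ → Fin m → ℝ) (k : ℕ) :
    (auxN y (k + 1)).det = (auxN y k).det * (1 + auxw y k) := by
  have h : auxN y (k + 1) = auxN y k + replicateCol Unit (y k) * replicateRow Unit (y k) := by
    rw [auxN, Finset.sum_range_succ, ← add_assoc, ← auxN, vecMulVec_eq Unit]
  rw [h, det_add_replicateCol_mul_replicateRow ((auxN_pd y k).det_pos.ne'.isUnit)]
  congr 1
  rw [Matrix.mul_assoc, ← replicateCol_mulVec, det_unique]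
  simp [auxw, Matrix.mul_apply, dotProduct]

lemma aux_logdet {m : ℕ} (y : ℕ → Fin m → ℝ) (k : ℕ) :
    Real.log (auxN y k).det = ∑ i ∈ Finset.range k, Real.log (1 + auxw y i) := by
  induction k with
  | zero => simp [auxN]
  | succ k ih =>
    rw [auxN_det_succ, Real.log_mul (auxN_pd y k).det_pos.ne', ih, Finset.sum_range_succ]
    have := auxw_nonneg y k
    linarith

lemma aux_logdet_le {m : ℕ} (hm : 1 ≤ m) (y : ℕ → Fin m → ℝ) (k : ℕ)
    (hy : ∀ i, y i ⬝ᵥ y i ≤ 1) :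
    Real.log (auxN y k).det ≤ m * Real.log (1 + k) := by
  have hpd := auxN_pd y k
  have hc : (0 : ℝ) < 1 + k := by positivity
  have htr : (auxN y k).trace ≤ m + k := by
    rw [auxN, trace_add, trace_one, trace_sum]
    simp only [trace_vecMulVec, Fintype.card_fin]
    have := Finset.sum_le_sum (s := Finset.range k) fun i _ => hy i
    simp at this
    linarith
  have h1 : (auxN y k).trace = ∑ i, hpd.isHermitian.eigenvalues i := by
    simpa using hpd.isHermitian.trace_eq_sum_eigenvalues
  have h2 : (auxN y k).det = ∏ i, hpd.isHermitian.eigenvalues i := by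
    simpa using hpd.isHermitian.det_eq_prod_eigenvalues
  have hpos := fun i => hpd.eigenvalues_pos i
  rw [h2, Real.log_prod (fun i _ => (hpos i).ne')]
  have h3 : ∀ i, Real.log (hpd.isHermitian.eigenvalues i) ≤
      Real.log (1 + k) + hpd.isHermitian.eigenvalues i / (1 + k) - 1 := by
    intro i
    have := Real.log_le_sub_one_of_pos (div_pos (hpos i) hc)
    rw [Real.log_div (hpos i).ne' hc.ne'] at this
    linarith
  refine (Finset.sum_le_sum fun i _ => h3 i).trans ?_
  rw [Finset.sum_sub_distrib, Finset.sum_add_distrib, ← Finset.sum_div, ← h1]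
  simp only [Finset.sum_const, Finset.card_univ, Fintype.card_fin, nsmul_eq_mul]
  have h4 : (auxN y k).trace / (1 + k) ≤ m := by
    rw [div_le_iff₀ hc]
    have : (1 : ℝ) ≤ m := by exact_mod_cast hm
    have hk : (0 : ℝ) ≤ k := by positivity
    nlinarith
  linarith

/-- Deterministic sum-of-rewards bound: on the ellipsoid event,
`Σ_t |μ̃_tᵀx_t − μᵀx_t| ≤ β √(2mT log(1+T))`. -/
theorem stmt_10 (m T : ℕ) (hm : 1 ≤ m) (hT : 1 ≤ T) (β : ℝ) (hβ : 0 ≤ β)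
    (x : Fin T → Fin m → ℝ) (hx : ∀ t, Real.sqrt (x t ⬝ᵥ x t) ≤ 1)
    (M : Fin T → Matrix (Fin m) (Fin m) ℝ)
    (hM : ∀ t, M t = (1 : Matrix (Fin m) (Fin m) ℝ) +
      ∑ i ∈ Finset.Iio t, vecMulVec (x i) (x i))
    (μ : Fin m → ℝ) (μtilde : Fin T → Fin m → ℝ)
    (hconf : ∀ t, Real.sqrt ((μtilde t - μ) ⬝ᵥ (M t).mulVec (μtilde t - μ)) ≤ β) :
    ∑ t, |μtilde t ⬝ᵥ x t - μ ⬝ᵥ x t| ≤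
      β * Real.sqrt (2 * m * T * Real.log (1 + T)) := by
  set y : ℕ → Fin m → ℝ := fun i => if h : i < T then x ⟨i, h⟩ else 0 with hydef
  have hyx : ∀ t : Fin T, y t = x t := fun t => by simp [hydef]
  have hy : ∀ i, y i ⬝ᵥ y i ≤ 1 := by
    intro i
    by_cases h : i < T
    · have := hx ⟨i, h⟩
      rw [Real.sqrt_le_one] at this
      simpa [hydef, h] using this
    · simp [hydef, h]
  have hMN : ∀ t : Fin T, M t = auxN y t := by
    intro t
    rw [hM, auxN]
    congr 1
    rw [← Nat.Iio_eq_range, ← Fin.map_valEmbedding_Iio, Finset.sum_map]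
    simp [hyx]
  have hterm : ∀ t : Fin T, |μtilde t ⬝ᵥ x t - μ ⬝ᵥ x t| ≤ β * Real.sqrt (auxw y t) := by
    intro t
    rw [← sub_dotProduct, ← hyx]
    have h := Real.abs_le_sqrt (aux_cs y t (μtilde t - μ))
    rw [Real.sqrt_mul' _ (auxw_nonneg y t), ← hMN] at h
    exact h.trans (mul_le_mul_of_nonneg_right (hconf t) (Real.sqrt_nonneg _))
  refine (Finset.sum_le_sum fun t _ => hterm t).trans ?_
  rw [← Finset.mul_sum]
  refine mul_le_mul_of_nonneg_left (Real.le_sqrt_of_sq_le ?_) hβ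
  have hcs := sq_sum_le_card_mul_sum_sq (s := (Finset.univ : Finset (Fin T)))
    (f := fun t => Real.sqrt (auxw y t))
  simp only [Real.sq_sqrt (auxw_nonneg y _), Finset.card_univ, Fintype.card_fin] at hcs
  refine hcs.trans ?_
  have hsum : ∑ t : Fin T, auxw y t ≤ 2 * (m * Real.log (1 + T)) := by
    rw [Fin.sum_univ_eq_sum_range (fun i => auxw y i)]
    refine (Finset.sum_le_sum fun i _ =>
      aux_log (auxw_nonneg y i) (auxw_le_one y i (hy i))).trans ?_
    rw [← Finset.mul_sum, ← aux_logdet]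
    have := aux_logdet_le hm y T hy
    linarith
  have hT0 : (0 : ℝ) ≤ T := by positivity
  have := mul_le_mul_of_nonneg_left hsum hT0
  linarith
end

section
/- Let t, m ≥ 1, λ > 0, ε ∈ [0, 1]. Let X ∈ ℝ^{t×m} be a matrix all of whose entries lie in [0, 1], let μ ∈ [0, 1]^m, γ ∈ [−1, 1]^m, and η ∈ ℝ^t. Set M := λ·I_m + XᵀX, μ̂ := M⁻¹ Xᵀ (Xμ + η), and s := Xᵀη − ε·XᵀXγ. Then ‖μ̂ − μ‖_M ≤ ‖s‖_{M⁻¹} + ε·m·√t + √(λ m). -/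
open Matrix

lemma dot_cs {ι : Type*} [Fintype ι] (a b : ι → ℝ) :
    a ⬝ᵥ b ≤ Real.sqrt (a ⬝ᵥ a) * Real.sqrt (b ⬝ᵥ b) := by
  have h := Real.sum_mul_le_sqrt_mul_sqrt Finset.univ a b
  simpa [dotProduct, pow_two] using h

lemma dot_elim {m t : ℕ} (a c : Fin m → ℝ) (b d : Fin t → ℝ) :
    (Sum.elim a b) ⬝ᵥ (Sum.elim c d) = a ⬝ᵥ c + b ⬝ᵥ d := by
  simp [dotProduct]

/-- Deterministic confidence-ellipsoid bound:
`‖μ̂ − μ‖_M ≤ ‖s‖_{M⁻¹} + ε·m·√t + √(λm)`. -/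
theorem stmt_14 (t m : ℕ) (ht : 1 ≤ t) (hm : 1 ≤ m) (lam ε : ℝ)
    (hlam : 0 < lam) (hε : ε ∈ Set.Icc (0 : ℝ) 1)
    (X : Matrix (Fin t) (Fin m) ℝ)
    (hX : ∀ i j, X i j ∈ Set.Icc (0 : ℝ) 1)
    (μ : Fin m → ℝ) (hμ : ∀ j, μ j ∈ Set.Icc (0 : ℝ) 1)
    (γ : Fin m → ℝ) (hγ : ∀ j, γ j ∈ Set.Icc (-1 : ℝ) 1)
    (η : Fin t → ℝ)
    (M : Matrix (Fin m) (Fin m) ℝ)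
    (hM : M = lam • (1 : Matrix (Fin m) (Fin m) ℝ) + Xᵀ * X)
    (μhat : Fin m → ℝ) (hμhat : μhat = M⁻¹.mulVec (Xᵀ.mulVec (X.mulVec μ + η)))
    (s : Fin m → ℝ) (hs : s = Xᵀ.mulVec η - ε • (Xᵀ * X).mulVec γ) :
    Real.sqrt ((μhat - μ) ⬝ᵥ M.mulVec (μhat - μ)) ≤
      Real.sqrt (s ⬝ᵥ M⁻¹.mulVec s) + ε * m * Real.sqrt t + Real.sqrt (lam * m) := by
  have hform : ∀ u v : Fin m → ℝ, u ⬝ᵥ M.mulVec v =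
      Sum.elim (Real.sqrt lam • u) (X.mulVec u) ⬝ᵥ Sum.elim (Real.sqrt lam • v) (X.mulVec v) := by
    intro u v
    rw [dot_elim, hM, add_mulVec, dotProduct_add, smul_mulVec, one_mulVec, ← mulVec_mulVec,
      dotProduct_mulVec u Xᵀ, vecMul_transpose, smul_dotProduct, dotProduct_smul, dotProduct_smul]
    simp only [smul_eq_mul]
    rw [← mul_assoc, Real.mul_self_sqrt hlam.le]
  have hpd : M.PosDef := by
    rw [hM]
    have h1 : (lam • (1 : Matrix (Fin m) (Fin m) ℝ)).PosDef := Matrix.PosDef.one.smul hlam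
    have h2 : (Xᵀ * X).PosSemidef := by
      simpa using Matrix.posSemidef_conjTranspose_mul_self X
    exact h1.add_posSemidef h2
  have hdet : IsUnit M.det := hpd.det_pos.ne'.isUnit
  have hinv : ∀ v, M.mulVec (M⁻¹.mulVec v) = v := by
    intro v
    rw [mulVec_mulVec, mul_nonsing_inv _ hdet, one_mulVec]
  set d := μhat - μ with hd
  have hMd : M.mulVec d = s + ε • (Xᵀ * X).mulVec γ - lam • μ := by
    rw [hd, mulVec_sub, hμhat, hinv, hs, mulVec_add]
    conv_lhs => rw [hM]
    rw [add_mulVec, smul_mulVec, one_mulVec, ← mulVec_mulVec]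
    abel
  set p := Sum.elim (Real.sqrt lam • d) (X.mulVec d) with hp
  have hN : d ⬝ᵥ M.mulVec d = p ⬝ᵥ p := hform d d
  have hpp : 0 ≤ p ⬝ᵥ p := by
    simp only [dotProduct]
    exact Finset.sum_nonneg fun i _ => mul_self_nonneg _
  -- the three terms
  have e1 : d ⬝ᵥ s ≤ Real.sqrt (p ⬝ᵥ p) * Real.sqrt (s ⬝ᵥ M⁻¹.mulVec s) := by
    have h1 := hform d (M⁻¹.mulVec s)
    have h2 := hform (M⁻¹.mulVec s) (M⁻¹.mulVec s)
    rw [hinv] at h1 h2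
    rw [h1, dotProduct_comm s, h2]
    exact dot_cs _ _
  have e2 : d ⬝ᵥ (Xᵀ * X).mulVec γ ≤ Real.sqrt (p ⬝ᵥ p) * (m * Real.sqrt t) := by
    have h1 : d ⬝ᵥ (Xᵀ * X).mulVec γ = p ⬝ᵥ Sum.elim (0 : Fin m → ℝ) (X.mulVec γ) := by
      rw [hp, dot_elim, dotProduct_zero, zero_add, ← mulVec_mulVec,
        dotProduct_mulVec d Xᵀ, vecMul_transpose]
    rw [h1]
    refine (dot_cs _ _).trans (mul_le_mul_of_nonneg_left ?_ (Real.sqrt_nonneg _))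
    rw [dot_elim, dotProduct_zero, zero_add]
    have hb : ∀ i, |X.mulVec γ i| ≤ m := by
      intro i
      have : |∑ j, X i j * γ j| ≤ ∑ j : Fin m, (1 : ℝ) := by
        refine (Finset.abs_sum_le_sum_abs _ _).trans (Finset.sum_le_sum fun j _ => ?_)
        rw [abs_mul]
        exact mul_le_one₀ (abs_le.2 ⟨by linarith [(hX i j).1], (hX i j).2⟩) (abs_nonneg _)
          (abs_le.2 (hγ j))
      simpa [mulVec, dotProduct] using this
    have hsum : X.mulVec γ ⬝ᵥ X.mulVec γ ≤ (m : ℝ) ^ 2 * t := by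
      have : ∑ i, X.mulVec γ i * X.mulVec γ i ≤ ∑ i : Fin t, (m : ℝ) ^ 2 := by
        refine Finset.sum_le_sum fun i _ => ?_
        have := abs_le.1 (hb i)
        nlinarith [this.1, this.2]
      simpa [dotProduct, mul_comm] using this
    calc _ ≤ Real.sqrt ((m : ℝ) ^ 2 * t) := Real.sqrt_le_sqrt hsum
      _ = _ := by rw [Real.sqrt_mul (by positivity), Real.sqrt_sq (by positivity)]
  have e3 : -(lam * (d ⬝ᵥ μ)) ≤ Real.sqrt (p ⬝ᵥ p) * Real.sqrt (lam * m) := by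
    have h1 : -(lam * (d ⬝ᵥ μ)) = p ⬝ᵥ Sum.elim (-(Real.sqrt lam • μ)) (0 : Fin t → ℝ) := by
      rw [hp, dot_elim, dotProduct_zero, add_zero, dotProduct_neg, smul_dotProduct,
        dotProduct_smul]
      simp only [smul_eq_mul]
      rw [← mul_assoc, Real.mul_self_sqrt hlam.le]
    rw [h1]
    refine (dot_cs _ _).trans (mul_le_mul_of_nonneg_left (Real.sqrt_le_sqrt ?_)
      (Real.sqrt_nonneg _))
    rw [dot_elim, dotProduct_zero, add_zero, neg_dotProduct_neg, smul_dotProduct,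
      dotProduct_smul]
    simp only [smul_eq_mul]
    rw [← mul_assoc, Real.mul_self_sqrt hlam.le]
    refine mul_le_mul_of_nonneg_left ?_ hlam.le
    have : ∑ j, μ j * μ j ≤ ∑ j : Fin m, (1 : ℝ) :=
      Finset.sum_le_sum fun j _ => mul_le_one₀ (hμ j).2 (hμ j).1 (hμ j).2
    simpa [dotProduct] using this
  have htot : p ⬝ᵥ p = d ⬝ᵥ s + ε * (d ⬝ᵥ (Xᵀ * X).mulVec γ) - lam * (d ⬝ᵥ μ) := by
    rw [← hN, hMd, dotProduct_sub, dotProduct_add, dotProduct_smul, dotProduct_smul]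
    simp only [smul_eq_mul]
  rw [hN]
  have e2' := mul_le_mul_of_nonneg_left e2 hε.1
  have hsq := Real.mul_self_sqrt hpp
  have hε0 := hε.1
  rcases (Real.sqrt_nonneg (p ⬝ᵥ p)).eq_or_lt with h0 | h0
  · rw [← h0]; positivity
  · refine le_of_mul_le_mul_left ?_ h0
    rw [hsq]
    linarith
end
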